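/- arXiv:0807.3603 — 4 statements merged into one kernel-verified Lean document; each statement's English description precedes it below -/
import Mathlib

section
/- For every τ in the complex upper half-plane, the derivative of the Jacobi theta function at u = 0 satisfies ∂ϑ/∂u (0;τ) = −2π η(τ)³. -/
open Complex Real Filter

noncomputable section

/-- The Jacobi theta function ϑ(u;τ) = Σ_{ν∈ℤ+1/2} e^{πiν²τ + 2πiν(u+1/2)}. -/
def jTheta (u τ : ℂ) : ℂ :=
  ∑' n : ℤ, Complex.exp (π * I * ((n : ℂ) + 1/2)^2 * τ + 2 * π * I * ((n : ℂ) + 1/2) * (u + 1/2))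

/-- ϑ₀(u;τ) = Σ_{n∈ℤ} e^{πin²τ + 2πinu}. -/
def jTheta0 (u τ : ℂ) : ℂ :=
  ∑' n : ℤ, Complex.exp (π * I * (n : ℂ)^2 * τ + 2 * π * I * (n : ℂ) * u)

/-- ϑ₁(u;τ) = Σ_{n∈1/2+ℤ} e^{πin²τ + 2πinu}. -/
def jTheta1 (u τ : ℂ) : ℂ :=
  ∑' n : ℤ, Complex.exp (π * I * ((n : ℂ) + 1/2)^2 * τ + 2 * π * I * ((n : ℂ) + 1/2) * u)

/-- The Dedekind eta function. -/
def dedekindEta (τ : ℂ) : ℂ :=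
  Complex.exp (π * I * τ / 12) * ∏' n : ℕ, (1 - Complex.exp (2 * π * I * ((n : ℂ) + 1) * τ))

/-- The Lerch sum μ(u,v;τ). -/
def lerchMu (u v τ : ℂ) : ℂ :=
  Complex.exp (π * I * u) / jTheta v τ *
    ∑' n : ℤ, (-1 : ℂ) ^ n * Complex.exp (π * I * ((n : ℂ)^2 + (n : ℂ)) * τ + 2 * π * I * v * (n : ℂ)) /
      (1 - Complex.exp (2 * π * I * (n : ℂ) * τ + 2 * π * I * u))

/-- a₀^{α,β}(τ). -/
def aCoef0 (α β : ℝ) (τ : ℂ) : ℂ :=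
  ∑' n : ℤ, ((n : ℂ) + (α : ℂ)/2) *
    Complex.exp (2 * π * I * (n : ℂ)^2 * τ + 2 * π * I * (n : ℂ) * ((α : ℂ) * τ + (β : ℂ)))

/-- a₁^{α,β}(τ). -/
def aCoef1 (α β : ℝ) (τ : ℂ) : ℂ :=
  ∑' n : ℤ, (((n : ℂ) + 1/2) + (α : ℂ)/2) *
    Complex.exp (2 * π * I * ((n : ℂ) + 1/2)^2 * τ + 2 * π * I * ((n : ℂ) + 1/2) * ((α : ℂ) * τ + (β : ℂ)))

/-- Finite q-Pochhammer symbol (a;q)_n. -/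
def qPochN (a q : ℂ) (n : ℕ) : ℂ := ∏ j ∈ Finset.range n, (1 - a * q ^ j)

/-- Infinite q-Pochhammer symbol (a;q)_∞. -/
def qPochInf (a q : ℂ) : ℂ := ∏' j : ℕ, (1 - a * q ^ j)

/-- The modified rank generating function R*(z;q). -/
def rankStar (z q : ℂ) : ℂ :=
  (qPochInf q q)⁻¹ * ∑' n : ℤ, (-1 : ℂ) ^ n * q ^ (n * (3 * n + 1) / 2) / (1 - z * q ^ n)

/-- The modified crank generating function C*(z;q). -/
def crankStar (z q : ℂ) : ℂ :=
  (1 - z)⁻¹ * ∏' n : ℕ, ((1 - q ^ (n + 1)) / ((1 - z * q ^ (n + 1)) * (1 - z⁻¹ * q ^ (n + 1))))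

/-- N(1,0,z;q), the overpartition-rank generating function. -/
def nGen10 (z q : ℂ) : ℂ :=
  ∑' n : ℕ, qPochN (-1) q n * q ^ (n * (n + 1) / 2) / (qPochN (z * q) q n * qPochN (z⁻¹ * q) q n)

/-- N*(1,0,z;q). -/
def nStar10 (z q : ℂ) : ℂ := nGen10 z q / (1 - z)

/-- N(1,1/q,z;q²), the M2-rank generating function for overpartitions. -/
def nGenM2over (z q : ℂ) : ℂ :=
  ∑' n : ℕ, qPochN (-1) (q^2) n * qPochN (-q) (q^2) n * q ^ n /
    (qPochN (z * q^2) (q^2) n * qPochN (z⁻¹ * q^2) (q^2) n)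

/-- N*(1,1/q,z;q²). -/
def nStarM2over (z q : ℂ) : ℂ := nGenM2over z q / (1 - z)

/-- N(0,1/q,z;q²), the M2-rank generating function for partitions without repeated odd parts. -/
def nGenM2 (z q : ℂ) : ℂ :=
  ∑' n : ℕ, qPochN (-q) (q^2) n * q ^ (n^2) /
    (qPochN (z * q^2) (q^2) n * qPochN (z⁻¹ * q^2) (q^2) n)

/-- N*(0,1/q,z;q²). -/
def nStarM2 (z q : ℂ) : ℂ := nGenM2 z q / (1 - z)

/-- The odd-rank generating function R^o(z;q). -/
def oddRank (z q : ℂ) : ℂ :=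
  (qPochInf (q^2) (q^2))⁻¹ * ∑' n : ℤ, (-1 : ℂ) ^ n * q ^ (3 * n^2 + 3 * n + 1) / (1 - z * q ^ (2 * n + 1))


open Topology in
/-- The partial products `(q;q)_n` converge to `(q;q)_∞`. -/
lemma tendsto_qPochN_self {q : ℂ} (hq : ‖q‖ < 1) :
    Tendsto (qPochN q q) atTop (𝓝 (qPochInf q q)) := by
  have h := (ModularForm.multipliable_one_sub_pow hq).hasProd.tendsto_prod_nat
  simp only [pow_succ'] at h
  exact h

lemma one_sub_pow_succ_ne_zero {q : ℂ} (hq : ‖q‖ < 1) (n : ℕ) : 1 - q ^ (n + 1) ≠ 0 := by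
  intro h
  have h1 : ‖q ^ (n + 1)‖ = 1 := by rw [← sub_eq_zero.mp h, norm_one]
  rw [norm_pow] at h1
  exact (pow_lt_one₀ (norm_nonneg q) hq n.succ_ne_zero).ne h1

lemma qPochN_self_ne_zero {q : ℂ} (hq : ‖q‖ < 1) (n : ℕ) : qPochN q q n ≠ 0 :=
  Finset.prod_ne_zero_iff.mpr fun j _ ↦ by
    simpa only [pow_succ'] using one_sub_pow_succ_ne_zero hq j

lemma qPochN_self_succ (q : ℂ) (n : ℕ) :
    qPochN q q (n + 1) = qPochN q q n * (1 - q ^ (n + 1)) := by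
  rw [qPochN, qPochN, Finset.prod_range_succ, pow_succ']

lemma qPochInf_self_ne_zero {q : ℂ} (hq : ‖q‖ < 1) : qPochInf q q ≠ 0 := by
  have h : ∏' j : ℕ, (1 + -q ^ (j + 1)) ≠ 0 := by
    refine tprod_one_add_ne_zero_of_summable (fun j ↦ ?_) ?_
    · simpa only [← sub_eq_add_neg] using one_sub_pow_succ_ne_zero hq j
    · simpa using (summable_nat_add_iff 1).mpr (summable_geometric_of_lt_one (norm_nonneg _) hq)
  simpa only [qPochInf, pow_succ', ← sub_eq_add_neg] using h

/-- The reciprocal `1 / (q;q)_k`, extended by zero to negative `k`. -/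
def invQPoch (q : ℂ) (k : ℤ) : ℂ := if k < 0 then 0 else (qPochN q q k.toNat)⁻¹

lemma invQPoch_of_neg (q : ℂ) {k : ℤ} (hk : k < 0) : invQPoch q k = 0 := if_pos hk

lemma invQPoch_natCast (q : ℂ) (k : ℕ) : invQPoch q k = (qPochN q q k)⁻¹ := by
  simp [invQPoch]

lemma invQPoch_eq_mul {q : ℂ} (hq : ‖q‖ < 1) (k : ℤ) :
    invQPoch q k = (1 - q ^ (k + 1)) * invQPoch q (k + 1) := by
  rcases lt_trichotomy k (-1) with hk | rfl | hk
  · rw [invQPoch_of_neg q (by lia), invQPoch_of_neg q (by lia), mul_zero]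
  · simp [invQPoch]
  · lift k to ℕ using by lia
    have h := one_sub_pow_succ_ne_zero hq k
    have h' := qPochN_self_ne_zero hq k
    rw [← Nat.cast_succ, invQPoch_natCast, invQPoch_natCast, Nat.succ_eq_add_one,
      qPochN_self_succ, zpow_natCast]
    field_simp

open Topology in
lemma tendsto_invQPoch {q : ℂ} (hq : ‖q‖ < 1) :
    Tendsto (invQPoch q) atTop (𝓝 (qPochInf q q)⁻¹) := by
  rw [← Nat.map_cast_int_atTop, tendsto_map'_iff]
  exact ((tendsto_qPochN_self hq).inv₀ (qPochInf_self_ne_zero hq)).congr fun k ↦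
    (invQPoch_natCast q k).symm

lemma exists_norm_invQPoch_le {q : ℂ} (hq : ‖q‖ < 1) : ∃ C, ∀ k, ‖invQPoch q k‖ ≤ C := by
  obtain ⟨C, hC⟩ := ((tendsto_qPochN_self hq).inv₀
    (qPochInf_self_ne_zero hq)).norm.bddAbove_range
  refine ⟨C, fun k ↦ ?_⟩
  have hbound (n : ℕ) : ‖(qPochN q q n)⁻¹‖ ≤ C := hC ⟨n, rfl⟩
  rcases lt_or_ge k 0 with hk | hk
  · rw [invQPoch_of_neg q hk, norm_zero]
    exact (norm_nonneg _).trans (hbound 0)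
  · lift k to ℕ using hk
    rw [invQPoch_natCast]
    exact hbound k

/-- A bi-infinite sequence whose ratios are `e (j + 1) / e j = -q ^ (j + 1)`, weighted by the
two reciprocal `q`-factorials of the symmetric `q`-binomial coefficient. -/
def finiteThetaTerm (q : ℂ) (e : ℤ → ℂ) (n : ℕ) (j : ℤ) : ℂ :=
  e j * invQPoch q (n - j) * invQPoch q (n + 1 + j)

lemma finiteThetaTerm_succ {q : ℂ} (hq : ‖q‖ < 1) (hq0 : q ≠ 0) {e : ℤ → ℂ}
    (he : ∀ j, e (j + 1) = -q ^ (j + 1) * e j) (n : ℕ) (j : ℤ) :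
    (1 - q ^ (2 * n + 2)) * (1 - q ^ (2 * n + 3)) * finiteThetaTerm q e (n + 1) j =
      (1 + q ^ (2 * n + 2)) * finiteThetaTerm q e n j -
        q ^ (n + 1) * (finiteThetaTerm q e n (j - 1) + finiteThetaTerm q e n (j + 1)) := by
  have hX : q ^ j ≠ 0 := zpow_ne_zero j hq0
  have he' : e (j - 1) = -(q ^ j)⁻¹ * e j := by
    have h := he (j - 1)
    rw [sub_add_cancel] at h
    rw [h]
    field_simp
  have a1 : invQPoch q (n - j) = (1 - q ^ n * q / q ^ j) * invQPoch q (n + 1 - j) := by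
    rw [invQPoch_eq_mul hq, show (n : ℤ) - j + 1 = n + 1 - j by ring, zpow_sub₀ hq0,
      zpow_add_one₀ hq0, zpow_natCast]
  have a2 : invQPoch q (n - (j + 1)) = (1 - q ^ n / q ^ j) * invQPoch q (n - j) := by
    rw [invQPoch_eq_mul hq, show (n : ℤ) - (j + 1) + 1 = n - j by ring, zpow_sub₀ hq0,
      zpow_natCast]
  have b1 : invQPoch q (n + 1 + j) =
      (1 - q ^ n * q ^ 2 * q ^ j) * invQPoch q (n + 2 + j) := by
    rw [invQPoch_eq_mul hq, show (n : ℤ) + 1 + j + 1 = n + 2 + j by ring, zpow_add₀ hq0,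
      zpow_add₀ hq0, zpow_natCast, zpow_ofNat]
  have b2 : invQPoch q (n + j) = (1 - q ^ n * q * q ^ j) * invQPoch q (n + 1 + j) := by
    rw [invQPoch_eq_mul hq, show (n : ℤ) + j + 1 = n + 1 + j by ring, zpow_add₀ hq0,
      zpow_add_one₀ hq0, zpow_natCast]
  simp only [finiteThetaTerm]
  rw [show ((n + 1 : ℕ) : ℤ) - j = n + 1 - j by push_cast; ring,
    show ((n + 1 : ℕ) : ℤ) + 1 + j = n + 2 + j by push_cast; ring,
    show (n : ℤ) - (j - 1) = n + 1 - j by ring, show (n : ℤ) + 1 + (j - 1) = n + j by ring,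
    show (n : ℤ) + 1 + (j + 1) = n + 2 + j by ring, he', he, a2, a1, b2, b1, zpow_add_one₀ hq0]
  field_simp
  ring

lemma finiteThetaTerm_eq_zero (q : ℂ) (e : ℤ → ℂ) {n : ℕ} {j : ℤ}
    (hj : j ∉ Finset.Icc (-(n : ℤ) - 1) n) : finiteThetaTerm q e n j = 0 := by
  rw [Finset.mem_Icc, not_and_or, not_le, not_le] at hj
  rcases hj with hj | hj
  · rw [finiteThetaTerm, invQPoch_of_neg q (show (n : ℤ) + 1 + j < 0 by lia), mul_zero]
  · rw [finiteThetaTerm, invQPoch_of_neg q (show (n : ℤ) - j < 0 by lia), mul_zero, zero_mul]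

lemma summable_mul_finiteThetaTerm (q : ℂ) (e : ℤ → ℂ) (n : ℕ) (g : ℤ → ℂ) :
    Summable fun j ↦ g j * finiteThetaTerm q e n j :=
  summable_of_ne_finset_zero (s := Finset.Icc (-(n : ℤ) - 1) n) fun j hj ↦ by
    rw [finiteThetaTerm_eq_zero q e hj, mul_zero]

/-- A finite form of Jacobi's identity for the cube of `(q;q)_∞`. -/
lemma qPochN_mul_tsum_finiteThetaTerm {q : ℂ} (hq : ‖q‖ < 1) (hq0 : q ≠ 0) {e : ℤ → ℂ}
    (he0 : e 0 = 1) (he : ∀ j, e (j + 1) = -q ^ (j + 1) * e j) (n : ℕ) :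
    qPochN q q (2 * n + 1) * ∑' j : ℤ, ((j : ℂ) + 1 / 2) * finiteThetaTerm q e n j =
      qPochN q q n ^ 2 := by
  induction n with
  | zero =>
    have he1 : e (-1) = -1 := by
      have h := he (-1)
      norm_num [he0] at h
      rw [h, neg_neg]
    have h1 : 1 - q ≠ 0 := by simpa using one_sub_pow_succ_ne_zero hq 0
    rw [tsum_eq_sum (s := Finset.Icc (-1 : ℤ) 0) fun j hj ↦ by
      rw [finiteThetaTerm_eq_zero q e (by simpa using hj), mul_zero]]
    rw [show Finset.Icc (-1 : ℤ) 0 = {-1, 0} by rfl, Finset.sum_pair (by norm_num)]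
    simp [finiteThetaTerm, invQPoch, he0, he1, qPochN]
    field_simp
    norm_num
  | succ n ih =>
    have hshift (k : ℤ) :
        ∑' j : ℤ, ((j : ℂ) + 1 / 2) * finiteThetaTerm q e n (j + k) =
          ∑' j : ℤ, ((j : ℂ) - k + 1 / 2) * finiteThetaTerm q e n j := by
      rw [← (Equiv.addRight k).tsum_eq (fun j : ℤ ↦ ((j : ℂ) - k + 1 / 2) * _)]
      simp
    have hsum (k : ℤ) : Summable fun j : ℤ ↦ ((j : ℂ) + 1 / 2) * finiteThetaTerm q e n (j + k) := by
      have h := summable_mul_finiteThetaTerm q e n fun j : ℤ ↦ (j : ℂ) - k + 1 / 2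
      rw [← (Equiv.addRight k).summable_iff] at h
      simpa [Function.comp_def] using h
    have hadd : ∑' j : ℤ, ((j : ℂ) + 1 / 2) * finiteThetaTerm q e n (j + -1) +
        ∑' j : ℤ, ((j : ℂ) + 1 / 2) * finiteThetaTerm q e n (j + 1) =
          2 * ∑' j : ℤ, ((j : ℂ) + 1 / 2) * finiteThetaTerm q e n j := by
      rw [hshift, hshift, ← Summable.tsum_add (summable_mul_finiteThetaTerm ..)
        (summable_mul_finiteThetaTerm ..), ← tsum_mul_left]
      refine tsum_congr fun j ↦ ?_
      push_cast
      ring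
    have hrec : (1 - q ^ (2 * n + 2)) * (1 - q ^ (2 * n + 3)) *
        ∑' j : ℤ, ((j : ℂ) + 1 / 2) * finiteThetaTerm q e (n + 1) j =
          (1 - q ^ (n + 1)) ^ 2 * ∑' j : ℤ, ((j : ℂ) + 1 / 2) * finiteThetaTerm q e n j := by
      calc
        _ = ∑' j : ℤ, ((1 + q ^ (2 * n + 2)) * (((j : ℂ) + 1 / 2) * finiteThetaTerm q e n j) -
              q ^ (n + 1) * (((j : ℂ) + 1 / 2) * finiteThetaTerm q e n (j + -1) +
                ((j : ℂ) + 1 / 2) * finiteThetaTerm q e n (j + 1))) := by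
          rw [← tsum_mul_left]
          refine tsum_congr fun j ↦ ?_
          rw [mul_left_comm, finiteThetaTerm_succ hq hq0 he, ← sub_eq_add_neg]
          ring
        _ = _ := by
          rw [Summable.tsum_sub ((summable_mul_finiteThetaTerm ..).mul_left _)
            (((hsum _).add (hsum _)).mul_left _), tsum_mul_left, tsum_mul_left,
            Summable.tsum_add (hsum _) (hsum _), hadd]
          ring
    rw [show 2 * (n + 1) + 1 = 2 * n + 1 + 1 + 1 by ring, qPochN_self_succ, qPochN_self_succ,
      qPochN_self_succ q n, mul_pow, ← ih]
    linear_combination qPochN q q (2 * n + 1) * hrec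

/-- Jacobi's identity: `∑ (j + 1/2) e_j = (q;q)_∞ ^ 3`. -/
lemma tsum_eq_qPochInf_pow_three {q : ℂ} (hq : ‖q‖ < 1) (hq0 : q ≠ 0) {e : ℤ → ℂ}
    (he0 : e 0 = 1) (he : ∀ j, e (j + 1) = -q ^ (j + 1) * e j)
    (hsum : Summable fun j : ℤ ↦ ((j : ℂ) + 1 / 2) * e j) :
    ∑' j : ℤ, ((j : ℂ) + 1 / 2) * e j = qPochInf q q ^ 3 := by
  have hP := qPochInf_self_ne_zero hq
  obtain ⟨C, hC⟩ := exists_norm_invQPoch_le hq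
  have hC0 : 0 ≤ C := (norm_nonneg _).trans (hC 0)
  have hlim : Tendsto (fun n : ℕ ↦ ∑' j : ℤ, ((j : ℂ) + 1 / 2) * finiteThetaTerm q e n j) atTop
      (nhds (∑' j : ℤ, ((j : ℂ) + 1 / 2) * e j * ((qPochInf q q)⁻¹ * (qPochInf q q)⁻¹))) := by
    refine tendsto_tsum_of_dominated_convergence
      (bound := fun j : ℤ ↦ ‖((j : ℂ) + 1 / 2) * e j‖ * (C * C)) (hsum.norm.mul_right _)
      (fun j ↦ ?_) (.of_forall fun n j ↦ ?_)
    · have h1 : Tendsto (fun n : ℕ ↦ (n : ℤ) - j) atTop atTop :=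
        tendsto_atTop_add_const_right _ (-j) tendsto_natCast_atTop_atTop
      have h2 : Tendsto (fun n : ℕ ↦ (n : ℤ) + 1 + j) atTop atTop :=
        tendsto_atTop_add_const_right _ j
          (tendsto_atTop_add_const_right _ 1 tendsto_natCast_atTop_atTop)
      refine ((((tendsto_invQPoch hq).comp h1).mul
        ((tendsto_invQPoch hq).comp h2)).const_mul (((j : ℂ) + 1 / 2) * e j)).congr fun n ↦ ?_
      simp only [finiteThetaTerm, Function.comp_apply]
      ring
    · rw [finiteThetaTerm, mul_assoc (e j), ← mul_assoc, norm_mul, norm_mul (invQPoch _ _)]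
      gcongr <;> apply hC
  have hodd : Tendsto (fun n : ℕ ↦ 2 * n + 1) atTop atTop :=
    tendsto_atTop_mono (fun n ↦ show n ≤ 2 * n + 1 by lia) tendsto_id
  have h := ((tendsto_qPochN_self hq).comp hodd).mul hlim
  simp only [Function.comp_apply, qPochN_mul_tsum_finiteThetaTerm hq hq0 he0 he] at h
  have h' := tendsto_nhds_unique h ((tendsto_qPochN_self hq).pow 2)
  rw [tsum_mul_right] at h'
  generalize ∑' j : ℤ, ((j : ℂ) + 1 / 2) * e j = S at h' ⊢
  field_simp at h'
  linear_combination h'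

lemma jTheta_eq_exp_mul_jacobiTheta₂ (u τ : ℂ) :
    jTheta u τ = cexp (π * I * τ / 4 + π * I * (u + 1 / 2)) *
      jacobiTheta₂ (u + (1 / 2 + τ / 2)) τ := by
  rw [jTheta, jacobiTheta₂, ← tsum_mul_left]
  refine tsum_congr fun n ↦ ?_
  rw [jacobiTheta₂_term, ← Complex.exp_add]
  ring_nf

/-- Termwise differentiation of the theta series at the origin. -/
lemma hasSum_deriv_jTheta_zero {τ : ℂ} (hτ : 0 < τ.im) :
    HasSum (fun n : ℤ ↦ -2 * π * cexp (π * I * τ / 4) *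
        (((n : ℂ) + 1 / 2) * cexp (π * I * n + π * I * τ * (n ^ 2 + n))))
      (deriv (fun u : ℂ ↦ jTheta u τ) 0) := by
  set z : ℂ := 1 / 2 + τ / 2 with hz
  have hθ : HasDerivAt (fun u ↦ jacobiTheta₂ (u + z) τ) (jacobiTheta₂' z τ) 0 := by
    have h := hasDerivAt_jacobiTheta₂_fst (0 + z) hτ
    rw [zero_add] at h
    exact HasDerivAt.comp_add_const (f := (jacobiTheta₂ · τ)) 0 z (by rwa [zero_add])
  have hE : HasDerivAt (fun u : ℂ ↦ cexp (π * I * τ / 4 + π * I * (u + 1 / 2)))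
      (cexp (π * I * τ / 4 + π * I * (0 + 1 / 2)) * (π * I * 1)) 0 :=
    (((((hasDerivAt_id (0 : ℂ)).add_const _).const_mul (π * I : ℂ))).const_add _).cexp
  have hD := hE.mul hθ
  have hfun : (fun u : ℂ ↦ jTheta u τ) = (fun u : ℂ ↦
      cexp (π * I * τ / 4 + π * I * (u + 1 / 2))) * fun u ↦ jacobiTheta₂ (u + z) τ :=
    funext fun u ↦ jTheta_eq_exp_mul_jacobiTheta₂ u τ
  have hI : cexp (π * I * τ / 4 + π * I * (0 + 1 / 2)) = cexp (π * I * τ / 4) * I := by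
    rw [Complex.exp_add, show (π * I * (0 + 1 / 2) : ℂ) = π / 2 * I by ring,
      Complex.exp_pi_div_two_mul_I]
  rw [hfun, hD.deriv, hI, zero_add]
  refine (((hasSum_jacobiTheta₂_term z hτ).mul_left _).add
    ((hasSum_jacobiTheta₂'_term z hτ).mul_left _)).congr_fun fun n ↦ ?_
  have hterm : jacobiTheta₂_term n z τ = cexp (π * I * n + π * I * τ * (n ^ 2 + n)) := by
    rw [jacobiTheta₂_term, hz]
    ring_nf
  rw [jacobiTheta₂'_term, hterm]
  linear_combination (-2 * π * cexp (π * I * τ / 4) *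
    (((n : ℂ) + 1 / 2) * cexp (π * I * n + π * I * τ * (n ^ 2 + n)))) * I_sq

lemma dedekindEta_eq_exp_mul_qPochInf (τ : ℂ) :
    dedekindEta τ =
      cexp (π * I * τ / 12) * qPochInf (cexp (2 * π * I * τ)) (cexp (2 * π * I * τ)) := by
  rw [dedekindEta, qPochInf]
  congr 1
  refine tprod_congr fun n ↦ ?_
  rw [← pow_succ', ← Complex.exp_nat_mul]
  push_cast
  ring_nf

/-- ϑ'(0;τ) = -2π η(τ)³. -/
theorem jTheta_deriv_zero (τ : ℂ) (hτ : 0 < τ.im) :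
    deriv (fun u : ℂ => jTheta u τ) 0 = -2 * π * dedekindEta τ ^ 3 := by
  have hq : ‖cexp (2 * π * I * τ)‖ < 1 := UpperHalfPlane.norm_exp_two_pi_I_lt_one ⟨τ, hτ⟩
  have hD := hasSum_deriv_jTheta_zero hτ
  have hc : (-2 * π * cexp (π * I * τ / 4) : ℂ) ≠ 0 := by
    simp [Real.pi_ne_zero]
  have hJ := tsum_eq_qPochInf_pow_three hq (Complex.exp_ne_zero _)
    (e := fun n : ℤ ↦ cexp (π * I * n + π * I * τ * (n ^ 2 + n))) (by simp) (fun j ↦ ?_)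
    ((summable_mul_left_iff hc).mp hD.summable)
  · rw [← hD.tsum_eq, tsum_mul_left, hJ, dedekindEta_eq_exp_mul_qPochInf, mul_pow,
      ← Complex.exp_nat_mul, ← mul_assoc]
    congr 3
    push_cast
    ring_nf
  · rw [← Complex.exp_int_mul, ← neg_one_mul, ← Complex.exp_pi_mul_I, ← Complex.exp_add,
      ← Complex.exp_add]
    push_cast
    ring_nf

end
end

section
/- Let τ be in the complex upper half-plane and let v ∈ ℂ with v ∉ ℤτ+ℤ. Then the Lerch sum u ↦ μ(u,v;τ) has a simple pole at u = 0 with residue −1/(2πi ϑ(v;τ)); that is, lim_{u→0} u · μ(u,v;τ) = −1/(2πi ϑ(v;τ)). -/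
open Complex Real Filter

noncomputable section

lemma tendsto_div_one_sub_cexp :
    Tendsto (fun u : ℂ => u / (1 - cexp (2 * π * I * u))) (nhdsWithin 0 {0}ᶜ)
      (nhds (-(1 / (2 * π * I)))) := by
  have hd : HasDerivAt (fun u : ℂ => cexp (2 * π * I * u)) (2 * π * I) 0 := by
    simpa using ((hasDerivAt_id (0 : ℂ)).const_mul (2 * π * I : ℂ)).cexp
  have h := (hasDerivAt_iff_tendsto_slope.mp hd).inv₀ Complex.two_pi_I_ne_zero
  refine (h.neg.congr fun u => ?_).trans (by simp)
  simp only [slope_def_field, mul_zero, Complex.exp_zero, sub_zero]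
  rw [inv_div, ← div_neg, neg_sub]

lemma norm_cexp_two_pi_I_mul (z : ℂ) :
    ‖cexp (2 * π * I * z)‖ = Real.exp (-(2 * π * z.im)) := by
  rw [Complex.norm_exp]
  congr 1
  simp [mul_re, mul_im]

/-- Away from the pole `n = 0`, the denominators of the Lerch sum are uniformly bounded below. -/
lemma le_norm_one_sub_cexp {τ u : ℂ} (hτ : 0 < τ.im) (hu : ‖u‖ ≤ τ.im / 2) {n : ℤ}
    (hn : n ≠ 0) :
    1 - Real.exp (-(π * τ.im)) ≤ ‖1 - cexp (2 * π * I * n * τ + 2 * π * I * u)‖ := by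
  have hui : |u.im| ≤ τ.im / 2 := (Complex.abs_im_le_norm u).trans hu
  obtain ⟨hu₁, hu₂⟩ := abs_le.mp hui
  have hnorm : ‖cexp (2 * π * I * n * τ + 2 * π * I * u)‖ =
      Real.exp (-(2 * π * (n * τ.im + u.im))) := by
    rw [show 2 * π * I * n * τ + 2 * π * I * u = 2 * π * I * (n * τ + u) by ring,
      norm_cexp_two_pi_I_mul]
    simp [mul_im]
  rcases lt_or_gt_of_ne hn with hneg | hpos
  · have hn' : (n : ℝ) ≤ -1 := by exact_mod_cast Int.le_sub_one_of_lt hneg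
    have hlin : n * τ.im + u.im ≤ -(τ.im / 2) := by nlinarith
    have hexp : Real.exp (π * τ.im) ≤ Real.exp (-(2 * π * (n * τ.im + u.im))) := by
      apply Real.exp_le_exp.mpr
      nlinarith [Real.pi_pos]
    have hinv : 2 ≤ Real.exp (π * τ.im) + Real.exp (-(π * τ.im)) := by
      linarith [Real.add_one_le_exp (π * τ.im), Real.add_one_le_exp (-(π * τ.im))]
    have htri := norm_sub_norm_le (cexp (2 * π * I * n * τ + 2 * π * I * u)) 1
    rw [norm_sub_rev, hnorm, norm_one] at htri
    linarith
  · have hn' : (1 : ℝ) ≤ n := by exact_mod_cast hpos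
    have hlin : τ.im / 2 ≤ n * τ.im + u.im := by nlinarith
    have hexp : Real.exp (-(2 * π * (n * τ.im + u.im))) ≤ Real.exp (-(π * τ.im)) := by
      apply Real.exp_le_exp.mpr
      nlinarith [Real.pi_pos]
    have htri := norm_sub_norm_le 1 (cexp (2 * π * I * n * τ + 2 * π * I * u))
    rw [hnorm, norm_one] at htri
    linarith

/-- The Lerch sum u ↦ μ(u,v;τ) has a simple pole at u = 0 with residue -1/(2πi ϑ(v;τ)). -/
theorem lerchMu_residue (τ v : ℂ) (hτ : 0 < τ.im)
    (hv : ∀ m n : ℤ, v ≠ (m : ℂ) * τ + (n : ℂ)) :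
    Filter.Tendsto (fun u : ℂ => u * lerchMu u v τ) (nhdsWithin 0 {0}ᶜ)
      (nhds (-(1 / (2 * π * I * jTheta v τ)))) := by
  set c : ℝ := 1 - Real.exp (-(π * τ.im)) with hc
  have hc₀ : 0 < c := by
    have : Real.exp (-(π * τ.im)) < 1 := Real.exp_lt_one_iff.mpr (by nlinarith [Real.pi_pos])
    linarith
  set a : ℤ → ℂ := fun n => (-1 : ℂ) ^ n *
    cexp (π * I * ((n : ℂ)^2 + (n : ℂ)) * τ + 2 * π * I * v * (n : ℂ)) with ha
  have hanorm (n : ℤ) : ‖a n‖ = ‖jacobiTheta₂_term n (v + τ / 2) τ‖ := by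
    simp only [ha, jacobiTheta₂_term, norm_mul, norm_zpow, norm_neg, norm_one, one_zpow, one_mul]
    ring_nf
  have hasum : Summable fun n => ‖a n‖ := by
    simp only [hanorm]
    exact ((summable_jacobiTheta₂_term_iff _ _).mpr hτ).norm
  set d : ℂ → ℤ → ℂ := fun u n =>
    1 - cexp (2 * π * I * (n : ℂ) * τ + 2 * π * I * u) with hd
  have hzero (u : ℂ) : u * (a 0 / d u 0) = u / (1 - cexp (2 * π * I * u)) := by
    simp [ha, hd, div_eq_mul_inv]
  have hid : Tendsto (fun u : ℂ => u) (nhdsWithin 0 {0}ᶜ) (nhds 0) :=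
    tendsto_id.mono_left nhdsWithin_le_nhds
  have hsmall (r : ℝ) (hr : 0 < r) : ∀ᶠ u : ℂ in nhdsWithin 0 {0}ᶜ, ‖u‖ ≤ r := by
    filter_upwards [hid.eventually (Metric.closedBall_mem_nhds 0 hr)] with u hu
    simpa using hu
  have hquot (u : ℂ) (hu : ‖u‖ ≤ τ.im / 2) (n : ℤ) (hn : n ≠ 0) :
      ‖a n / d u n‖ ≤ c⁻¹ * ‖a n‖ := by
    rw [norm_div, div_eq_inv_mul]
    gcongr
    exact le_norm_one_sub_cexp hτ hu hn
  have hsum : Tendsto (fun u : ℂ => ∑' n : ℤ, u * (a n / d u n)) (nhdsWithin 0 {0}ᶜ)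
      (nhds (∑' n : ℤ, if n = 0 then -(1 / (2 * π * I)) else 0)) := by
    refine tendsto_tsum_of_dominated_convergence (bound := fun n => (1 + c⁻¹) * ‖a n‖)
      (hasum.mul_left _) (fun n => ?_) ?_
    · rcases eq_or_ne n 0 with rfl | hn
      · simpa only [hzero, if_true] using tendsto_div_one_sub_cexp
      · rw [if_neg hn]
        refine squeeze_zero_norm' (a := fun u : ℂ => ‖u‖ * (c⁻¹ * ‖a n‖)) ?_ ?_
        · filter_upwards [hsmall _ (half_pos hτ)] with u hu
          rw [norm_mul]
          gcongr
          exact hquot u hu n hn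
        · simpa using hid.norm.mul_const (c⁻¹ * ‖a n‖)
    · have hlim : ‖(-(1 / (2 * π * I)) : ℂ)‖ < 1 := by
        simp only [norm_neg, norm_div, norm_mul, norm_one, norm_I, Complex.norm_ofNat,
          Complex.norm_real, Real.norm_eq_abs, abs_of_pos Real.pi_pos, mul_one]
        rw [div_lt_one (by positivity)]
        linarith [Real.pi_gt_three]
      filter_upwards [tendsto_div_one_sub_cexp.norm.eventually_lt_const hlim,
        hsmall _ (half_pos hτ), hsmall 1 one_pos] with u hu₀ hu hu₁ n
      rcases eq_or_ne n 0 with rfl | hn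
      · have ha₀ : ‖a 0‖ = 1 := by simp [ha]
        rw [hzero, ha₀, mul_one]
        linarith [inv_pos.mpr hc₀]
      · rw [norm_mul]
        calc ‖u‖ * ‖a n / d u n‖ ≤ 1 * (c⁻¹ * ‖a n‖) := by
              gcongr
              exact hquot u hu n hn
          _ ≤ (1 + c⁻¹) * ‖a n‖ := by nlinarith [norm_nonneg (a n)]
  rw [tsum_ite_eq] at hsum
  have hexp : Tendsto (fun u : ℂ => cexp (π * I * u) / jTheta v τ) (nhdsWithin 0 {0}ᶜ)
      (nhds (1 / jTheta v τ)) := by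
    have hcont : Continuous fun u : ℂ => cexp (π * I * u) / jTheta v τ := by fun_prop
    simpa using (hcont.tendsto 0).mono_left nhdsWithin_le_nhds
  have hlimit : 1 / jTheta v τ * -(1 / (2 * π * I)) = -(1 / (2 * π * I * jTheta v τ)) := by
    rw [mul_neg, one_div_mul_one_div, mul_comm (jTheta v τ)]
  rw [← hlimit]
  refine (hexp.mul hsum).congr fun u => ?_
  rw [tsum_mul_left, lerchMu]
  ring

end
end

section
/- For every τ in the complex upper half-plane and all v₁, v₂ ∈ ℂ, one has ϑ₀(v₁+v₂; 2τ) ϑ₁(v₁−v₂; 2τ) − ϑ₁(v₁+v₂; 2τ) ϑ₀(v₁−v₂; 2τ) = ϑ(v₁; τ) ϑ(v₂; τ). -/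
open Complex Real Filter

noncomputable section

/-- The pairs of integers with odd sum and those with even sum, each reparametrized by half the sum
and half the difference. -/
def paritySumEquiv : (ℤ × ℤ) ⊕ (ℤ × ℤ) ≃ ℤ × ℤ :=
  Equiv.ofBijective
    (Sum.elim (fun p ↦ (p.1 + p.2, p.1 - p.2 - 1)) (fun p ↦ (p.1 + p.2, p.1 - p.2))) <| by
    constructor
    · rintro (⟨a, b⟩ | ⟨a, b⟩) (⟨c, d⟩ | ⟨c, d⟩) h <;>
        simp only [Sum.elim_inl, Sum.elim_inr, Prod.mk.injEq, Sum.inl.injEq, Sum.inr.injEq,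
          reduceCtorEq] at h ⊢ <;> omega
    · rintro ⟨m, n⟩
      rcases Int.emod_two_eq_zero_or_one (m + n) with h | h
      · refine ⟨Sum.inr ((m + n) / 2, (m - n) / 2), ?_⟩
        simp only [Sum.elim_inr, Prod.mk.injEq]
        omega
      · refine ⟨Sum.inl ((m + n + 1) / 2, (m - n - 1) / 2), ?_⟩
        simp only [Sum.elim_inl, Prod.mk.injEq]
        omega

@[simp]
lemma paritySumEquiv_inl (p : ℤ × ℤ) :
    paritySumEquiv (Sum.inl p) = (p.1 + p.2, p.1 - p.2 - 1) := rfl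

@[simp]
lemma paritySumEquiv_inr (p : ℤ × ℤ) :
    paritySumEquiv (Sum.inr p) = (p.1 + p.2, p.1 - p.2) := rfl

lemma summable_jTheta0 (u : ℂ) {τ : ℂ} (hτ : 0 < τ.im) :
    Summable fun n : ℤ ↦ cexp (π * I * (n : ℂ) ^ 2 * τ + 2 * π * I * (n : ℂ) * u) := by
  refine ((summable_jacobiTheta₂_term_iff u τ).2 hτ).congr fun n ↦ ?_
  rw [jacobiTheta₂_term, add_comm]

lemma summable_jTheta1 (u : ℂ) {τ : ℂ} (hτ : 0 < τ.im) :
    Summable fun n : ℤ ↦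
      cexp (π * I * ((n : ℂ) + 1/2) ^ 2 * τ + 2 * π * I * ((n : ℂ) + 1/2) * u) := by
  refine ((summable_jTheta0 (u + τ / 2) hτ).mul_left (cexp (π * I * τ / 4 + π * I * u))).congr
    fun n ↦ ?_
  rw [← Complex.exp_add]
  ring_nf

/-- The theta relation of Lemma 2.3. -/
theorem theta_relation (τ : ℂ) (hτ : 0 < τ.im) (v₁ v₂ : ℂ) :
    jTheta0 (v₁ + v₂) (2 * τ) * jTheta1 (v₁ - v₂) (2 * τ)
      - jTheta1 (v₁ + v₂) (2 * τ) * jTheta0 (v₁ - v₂) (2 * τ)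
    = jTheta v₁ τ * jTheta v₂ τ := by
  have h2τ : 0 < (2 * τ).im := by simpa using hτ
  have hsum0 (u : ℂ) := (summable_jTheta0 u h2τ).norm
  have hsum1 (u : ℂ) := (summable_jTheta1 u h2τ).norm
  have hsum (u : ℂ) := (summable_jTheta1 (u + 1/2) hτ).norm
  have hprod := summable_mul_of_summable_norm (hsum v₁) (hsum v₂)
  have hsplit := paritySumEquiv.summable_iff.2 hprod
  unfold jTheta jTheta0 jTheta1
  rw [tsum_mul_tsum_of_summable_norm (hsum0 _) (hsum1 _),
    tsum_mul_tsum_of_summable_norm (hsum1 _) (hsum0 _),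
    tsum_mul_tsum_of_summable_norm (hsum _) (hsum _), sub_eq_add_neg, ← tsum_neg]
  conv_rhs => rw [← paritySumEquiv.tsum_eq]
  refine Eq.trans ?_ (Summable.tsum_sum (hsplit.comp_injective Sum.inl_injective)
    (hsplit.comp_injective Sum.inr_injective)).symm
  congr 1 <;> refine tsum_congr fun ⟨p, q⟩ ↦ ?_
  · simp only [Function.comp_apply, paritySumEquiv_inl, ← Complex.exp_add]
    refine Complex.exp_eq_exp_iff_exists_int.2 ⟨-p, ?_⟩
    push_cast
    ring
  · simp only [Function.comp_apply, paritySumEquiv_inr, ← Complex.exp_add]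
    rw [← neg_one_mul, ← Complex.exp_pi_mul_I, ← Complex.exp_add]
    refine Complex.exp_eq_exp_iff_exists_int.2 ⟨-p, ?_⟩
    push_cast
    ring

end
end

section
/- For every τ in the complex upper half-plane and all α, β ∈ ℝ, one has a₀^{α,β}(τ) ϑ₁(ατ+β; 2τ) − a₁^{α,β}(τ) ϑ₀(ατ+β; 2τ) = (i/2) η(τ)³ ϑ(ατ+β; τ). -/
open Complex Real Filter

noncomputable section

/-- The product `(1 - q)(1 - q²)⋯(1 - qⁿ)`. -/
def eulerProd (q : ℂ) (n : ℕ) : ℂ := ∏ i ∈ Finset.range n, (1 - q ^ (i + 1))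

/-- The Gaussian binomial coefficient, defined through the `q`-Pascal rule. -/
def gaussBinom (q : ℂ) : ℕ → ℕ → ℂ
  | _, 0 => 1
  | 0, _ + 1 => 0
  | n + 1, k + 1 => q ^ (k + 1) * gaussBinom q n (k + 1) + gaussBinom q n k

lemma gaussBinom_zero_right (q : ℂ) (n : ℕ) : gaussBinom q n 0 = 1 := by
  cases n <;> rfl

lemma gaussBinom_succ_succ (q : ℂ) (n k : ℕ) :
    gaussBinom q (n + 1) (k + 1) = q ^ (k + 1) * gaussBinom q n (k + 1) + gaussBinom q n k := rfl

lemma gaussBinom_eq_zero_of_lt (q : ℂ) {n k : ℕ} (h : n < k) : gaussBinom q n k = 0 := by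
  induction n generalizing k with
  | zero => obtain ⟨k, rfl⟩ := Nat.exists_eq_succ_of_ne_zero h.ne'; rfl
  | succ n ih =>
    obtain ⟨k, rfl⟩ := Nat.exists_eq_succ_of_ne_zero (Nat.ne_zero_of_lt h)
    rw [Nat.succ_eq_add_one, gaussBinom_succ_succ, ih (by omega), ih (by omega)]
    simp

lemma eulerProd_succ (q : ℂ) (n : ℕ) :
    eulerProd q (n + 1) = eulerProd q n * (1 - q ^ (n + 1)) :=
  Finset.prod_range_succ _ _

lemma gaussBinom_self (q : ℂ) (n : ℕ) : gaussBinom q n n = 1 := by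
  induction n with
  | zero => rfl
  | succ n ih => rw [gaussBinom_succ_succ, gaussBinom_eq_zero_of_lt q n.lt_succ_self, ih]; simp

lemma gaussBinom_add_mul_eulerProd (q : ℂ) (n k : ℕ) :
    gaussBinom q (n + k) k * (eulerProd q k * eulerProd q n) = eulerProd q (n + k) := by
  induction k generalizing n with
  | zero => simp [gaussBinom_zero_right, eulerProd]
  | succ k ihk =>
    induction n with
    | zero => simp [gaussBinom_self, eulerProd]
    | succ n ihn =>
      have h1 := ihk (n + 1)
      have h2 : n + 1 + (k + 1) = (n + (k + 1)) + 1 := by omega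
      rw [show n + 1 + k = n + (k + 1) by omega] at h1
      rw [h2, gaussBinom_succ_succ, eulerProd_succ q (n + (k + 1))]
      calc _ = q ^ (k + 1) * (1 - q ^ (n + 1)) *
              (gaussBinom q (n + (k + 1)) (k + 1) * (eulerProd q (k + 1) * eulerProd q n))
            + (1 - q ^ (k + 1)) *
              (gaussBinom q (n + (k + 1)) k * (eulerProd q k * eulerProd q (n + 1))) := by
              rw [eulerProd_succ q n, eulerProd_succ q k]; ring
        _ = _ := by rw [ihn, h1]; ring

/-- The finite `q`-binomial theorem, in homogeneous form. -/
lemma prod_add_mul_pow_eq_sum_gaussBinom (q x y : ℂ) (n : ℕ) :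
    ∏ i ∈ Finset.range n, (y + x * q ^ i) =
      ∑ k ∈ Finset.range (n + 1), gaussBinom q n k * q ^ k.choose 2 * x ^ k * y ^ (n - k) := by
  induction n generalizing x with
  | zero => simp [gaussBinom_zero_right]
  | succ n ih =>
    have h := ih (x * q)
    rw [Finset.prod_range_succ']
    have h1 : ∀ i ∈ Finset.range n, y + x * q ^ (i + 1) = y + x * q * q ^ i := by
      intros; ring
    rw [Finset.prod_congr rfl h1, h, Finset.sum_range_succ' _ (n + 1)]
    have h2 : ∑ k ∈ Finset.range (n + 1), gaussBinom q (n + 1) (k + 1) * q ^ (k + 1).choose 2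
          * x ^ (k + 1) * y ^ (n + 1 - (k + 1)) =
        x * ∑ k ∈ Finset.range (n + 1), gaussBinom q n k * q ^ k.choose 2 * (x * q) ^ k * y ^ (n - k)
        + y * ∑ k ∈ Finset.range n, gaussBinom q n (k + 1) * q ^ (k + 1).choose 2
          * (x * q) ^ (k + 1) * y ^ (n - (k + 1)) := by
      have h3 : ∑ k ∈ Finset.range n, y * (gaussBinom q n (k + 1) * q ^ (k + 1).choose 2
          * (x * q) ^ (k + 1) * y ^ (n - (k + 1))) =
          ∑ k ∈ Finset.range (n + 1), gaussBinom q n (k + 1) * q ^ (k + 1).choose 2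
          * (x * q) ^ (k + 1) * y ^ (n - k) := by
        rw [Finset.sum_range_succ, gaussBinom_eq_zero_of_lt q n.lt_succ_self]
        simp only [zero_mul, add_zero]
        refine Finset.sum_congr rfl fun k hk ↦ ?_
        rw [show n - k = n - (k + 1) + 1 by have := Finset.mem_range.1 hk; omega]
        ring
      rw [Finset.mul_sum, Finset.mul_sum, h3, ← Finset.sum_add_distrib]
      refine Finset.sum_congr rfl fun k _ ↦ ?_
      rw [gaussBinom_succ_succ, Nat.succ_sub_succ,
        show (k + 1).choose 2 = k + k.choose 2 by simp [Nat.choose_succ_succ' k 1]]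
      ring
    rw [h2, Finset.sum_range_succ' _ n]
    simp only [gaussBinom_zero_right]
    simp
    ring

lemma prod_range_sub_pow (q : ℂ) (n : ℕ) :
    ∏ i ∈ Finset.range n, (q ^ n - q ^ i) = (-1) ^ n * q ^ n.choose 2 * eulerProd q n := by
  have h : ∀ i ∈ Finset.range n, q ^ n - q ^ i = -1 * q ^ i * (1 - q ^ (n - 1 - i + 1)) := by
    intro i hi
    have := Finset.mem_range.1 hi
    have h2 : q ^ n = q ^ i * q ^ (n - 1 - i + 1) := by rw [← pow_add]; congr 1; omega
    rw [h2]; ring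
  rw [Finset.prod_congr rfl h, Finset.prod_mul_distrib, Finset.prod_mul_distrib,
    Finset.prod_pow_eq_pow_sum, Finset.sum_range_id, ← Nat.choose_two_right,
    Finset.prod_range_reflect (fun i ↦ 1 - q ^ (i + 1)) n]
  simp [eulerProd]

lemma sum_gaussBinom_mul_deriv (q : ℂ) (N : ℕ) :
    ∑ k ∈ Finset.range (2 * N + 2), gaussBinom q (2 * N + 1) k * q ^ k.choose 2 *
        (k * (-1) ^ (k - 1)) * (q ^ N) ^ (2 * N + 1 - k) =
      q ^ N * (((-1) ^ N * q ^ N.choose 2 * eulerProd q N) * (q ^ (N * N) * eulerProd q N)) := by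
  set y := q ^ N with hy
  have hl : HasDerivAt (fun x : ℂ ↦ ∑ k ∈ Finset.range (2 * N + 2),
      gaussBinom q (2 * N + 1) k * q ^ k.choose 2 * x ^ k * y ^ (2 * N + 1 - k))
      (∑ k ∈ Finset.range (2 * N + 2), gaussBinom q (2 * N + 1) k * q ^ k.choose 2 *
        (k * (-1) ^ (k - 1)) * y ^ (2 * N + 1 - k)) (-1) := by
    refine HasDerivAt.fun_sum fun k _ ↦ ?_
    exact ((hasDerivAt_pow k (-1 : ℂ)).const_mul _).mul_const _
  set R : ℂ → ℂ := fun x ↦ (∏ i ∈ Finset.range N, (y + x * q ^ i)) *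
    ∏ i ∈ Finset.range N, (y + x * q ^ (N + 1 + i)) with hR
  have hRd : DifferentiableAt ℂ R (-1) := by
    refine DifferentiableAt.mul ?_ ?_ <;>
    exact DifferentiableAt.fun_finsetProd fun i _ ↦ by fun_prop
  have hr : HasDerivAt (fun x : ℂ ↦ (y + x * q ^ N) * R x) (q ^ N * R (-1)) (-1) := by
    have h1 : HasDerivAt (fun x : ℂ ↦ y + x * q ^ N) (1 * q ^ N) (-1) :=
      ((hasDerivAt_id (-1 : ℂ)).mul_const (q ^ N)).const_add y
    exact (h1.mul hRd.hasDerivAt).congr_deriv (by simp [hy])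
  have hfun : (fun x : ℂ ↦ ∑ k ∈ Finset.range (2 * N + 2),
      gaussBinom q (2 * N + 1) k * q ^ k.choose 2 * x ^ k * y ^ (2 * N + 1 - k)) =
      fun x ↦ (y + x * q ^ N) * R x := by
    funext x
    rw [← prod_add_mul_pow_eq_sum_gaussBinom, show 2 * N + 1 = (N + 1) + N by omega,
      Finset.prod_range_add, Finset.prod_range_succ]
    simp only [hR]
    ring
  rw [hfun] at hl
  rw [hl.unique hr]
  congr 1
  simp only [hR, hy]
  congr 1
  · rw [← prod_range_sub_pow]
    exact Finset.prod_congr rfl fun i _ ↦ by ring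
  · rw [eulerProd, pow_mul]
    rw [show (q ^ N) ^ N = ∏ _i ∈ Finset.range N, q ^ N by simp, ← Finset.prod_mul_distrib]
    exact Finset.prod_congr rfl fun i _ ↦ by ring

/-- A finite form of Jacobi's identity for the cube of the Euler product. -/
lemma sum_gaussBinom_eq_eulerProd_sq {q : ℂ} (hq : q ≠ 0) {N : ℕ}
    (hQ : ∀ n, eulerProd q n ≠ 0) :
    ∑ j ∈ Finset.range (N + 1), (-1) ^ j * (2 * j + 1) * q ^ (j + 1).choose 2 *
      (eulerProd q (2 * N + 1) / (eulerProd q (N + 1 + j) * eulerProd q (N - j))) =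
      eulerProd q N ^ 2 := by
  have h := sum_gaussBinom_mul_deriv q N
  rw [show 2 * N + 2 = (N + 1) + (N + 1) by omega, Finset.sum_range_add,
    ← Finset.sum_range_reflect, ← Finset.sum_add_distrib] at h
  have hne : (-1 : ℂ) ^ N * q ^ (N.choose 2 + N * N + N) ≠ 0 := by
    simp [hq]
  have gb : ∀ a b, a + b = 2 * N + 1 → gaussBinom q (2 * N + 1) b =
      eulerProd q (2 * N + 1) / (eulerProd q b * eulerProd q a) := by
    intro a b hab
    rw [eq_div_iff (mul_ne_zero (hQ _) (hQ _)), ← hab, gaussBinom_add_mul_eulerProd]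
  apply mul_left_cancel₀ hne
  rw [Finset.mul_sum]
  trans q ^ N * ((-1) ^ N * q ^ N.choose 2 * eulerProd q N * (q ^ (N * N) * eulerProd q N))
  swap
  · ring
  rw [← h]
  refine Finset.sum_congr rfl fun j hj ↦ ?_
  have hj' := Finset.mem_range.1 hj
  obtain ⟨i, rfl⟩ : ∃ i, N = i + j := ⟨N - j, by omega⟩
  have ch : ∀ a b : ℕ, (a + b).choose 2 = a.choose 2 + b.choose 2 + a * b := by
    intro a b
    induction b with
    | zero => simp
    | succ b ih =>
      rw [← add_assoc, Nat.choose_succ_succ' (a + b) 1, Nat.choose_succ_succ' b 1, ih]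
      simp; ring
  have ch2 : j * j = 2 * j.choose 2 + j := by
    rw [Nat.choose_two_right, Nat.mul_div_cancel' (Nat.even_mul_pred_self j).two_dvd]
    cases j <;> simp; ring
  have e1 : i + j + 1 - 1 - j = i := by omega
  have e2 : i + j - j = i := by omega
  rw [e1, e2, gb (i + j + 1 + j) i (by omega), gb i (i + j + 1 + j) (by omega)]
  have p1 : (i + j).choose 2 + (i + j) * (i + j) + (i + j) + (j + 1).choose 2 =
      i.choose 2 + (i + j) * (2 * (i + j) + 1 - i) := by
    rw [show 2 * (i + j) + 1 - i = i + 2 * j + 1 by omega, ch, ch]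
    simp; nlinarith
  have p2 : (i + j).choose 2 + (i + j) * (i + j) + (i + j) + (j + 1).choose 2 =
      (i + j + 1 + j).choose 2 + (i + j) * (2 * (i + j) + 1 - (i + j + 1 + j)) := by
    rw [show 2 * (i + j) + 1 - (i + j + 1 + j) = i by omega, add_assoc (i + j), ch (i + j),
      add_comm 1 j]
    nlinarith
  have s1 : (i : ℂ) * (-1) ^ (i - 1) = - (i * (-1) ^ (i + j) * (-1) ^ j) := by
    rw [mul_assoc, ← pow_add, add_assoc, pow_add, ← two_mul]
    cases i <;> simp [pow_succ]
  have s2 : (-1 : ℂ) ^ (i + j + 1 + j - 1) = (-1) ^ (i + j) * (-1) ^ j := by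
    rw [← pow_add]; congr 1; omega
  rw [s1, s2, ← pow_mul, ← pow_mul]
  calc _ = (-1) ^ (i + j) * (-1) ^ j * (2 * j + 1) *
        q ^ ((i + j).choose 2 + (i + j) * (i + j) + (i + j) + (j + 1).choose 2) *
        (eulerProd q (2 * (i + j) + 1) / (eulerProd q (i + j + 1 + j) * eulerProd q i)) := by
        rw [pow_add q _ ((j + 1).choose 2)]; ring
    _ = (-1) ^ (i + j) * (-1) ^ j * (i + j + 1 + j) *
        q ^ ((i + j).choose 2 + (i + j) * (i + j) + (i + j) + (j + 1).choose 2) *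
        (eulerProd q (2 * (i + j) + 1) / (eulerProd q (i + j + 1 + j) * eulerProd q i))
        - (-1) ^ (i + j) * (-1) ^ j * i *
        q ^ ((i + j).choose 2 + (i + j) * (i + j) + (i + j) + (j + 1).choose 2) *
        (eulerProd q (2 * (i + j) + 1) / (eulerProd q (i + j + 1 + j) * eulerProd q i)) := by
        ring
    _ = _ := by
        nth_rewrite 1 [p2]
        rw [p1, pow_add, pow_add, mul_comm (eulerProd q i)]
        push_cast
        ring

lemma eulerProd_ne_zero {q : ℂ} (hq : ‖q‖ < 1) (n : ℕ) : eulerProd q n ≠ 0 := by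
  refine Finset.prod_ne_zero_iff.2 fun i _ h ↦ ?_
  have h1 : ‖q ^ (i + 1)‖ = 1 := by rw [← sub_eq_zero.1 h, norm_one]
  rw [norm_pow] at h1
  exact (pow_lt_one₀ (norm_nonneg q) hq i.succ_ne_zero).ne h1

lemma tendsto_eulerProd {q : ℂ} (hq : ‖q‖ < 1) :
    Tendsto (eulerProd q) atTop (nhds (∏' n : ℕ, (1 - q ^ (n + 1)))) :=
  (ModularForm.multipliable_one_sub_pow hq).hasProd.tendsto_prod_nat

lemma tprod_one_sub_pow_ne_zero {q : ℂ} (hq : ‖q‖ < 1) :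
    ∏' n : ℕ, (1 - q ^ (n + 1)) ≠ 0 := by
  simp_rw [sub_eq_add_neg]
  refine tprod_one_add_ne_zero_of_summable (fun i h ↦ ?_) ?_
  · have h1 : ‖q ^ (i + 1)‖ = 1 := by
      rw [← sub_eq_zero.1 ((sub_eq_add_neg _ _).trans h), norm_one]
    rw [norm_pow] at h1
    exact (pow_lt_one₀ (norm_nonneg q) hq i.succ_ne_zero).ne h1
  · simpa using (summable_nat_add_iff 1).mpr (summable_geometric_of_lt_one (norm_nonneg _) hq)

lemma summable_norm_mul_pow_choose {q : ℂ} (hq : ‖q‖ < 1) :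
    Summable fun j : ℕ ↦ ‖(-1) ^ j * (2 * j + 1) * q ^ (j + 1).choose 2‖ := by
  have h0 : ‖‖q‖‖ < 1 := by simpa using hq
  have h : Summable fun j : ℕ ↦ 2 * ((j : ℝ) ^ 1 * ‖q‖ ^ j) + (j : ℝ) ^ 0 * ‖q‖ ^ j :=
    ((summable_pow_mul_geometric_of_norm_lt_one 1 h0).mul_left 2).add
      (summable_pow_mul_geometric_of_norm_lt_one 0 h0)
  refine h.of_nonneg_of_le (fun _ ↦ norm_nonneg _) fun j ↦ ?_
  have h1 : ‖(2 * j + 1 : ℂ)‖ = 2 * j + 1 := by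
    exact_mod_cast Complex.norm_natCast (2 * j + 1)
  have h2 : ‖q‖ ^ (j + 1).choose 2 ≤ ‖q‖ ^ j := by
    refine pow_le_pow_of_le_one (norm_nonneg _) hq.le ?_
    simp [Nat.choose_succ_succ' j 1]
  simp only [norm_mul, norm_pow, norm_neg, norm_one, one_pow, one_mul, h1, pow_one, pow_zero]
  nlinarith [mul_le_mul_of_nonneg_left h2 (by positivity : (0 : ℝ) ≤ 2 * j + 1)]

/-- Jacobi's identity for the cube of the Euler product. -/
lemma tprod_one_sub_pow_cube {q : ℂ} (hq0 : q ≠ 0) (hq : ‖q‖ < 1) :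
    (∏' n : ℕ, (1 - q ^ (n + 1))) ^ 3 =
      ∑' j : ℕ, (-1) ^ j * (2 * j + 1) * q ^ (j + 1).choose 2 := by
  set L := ∏' n : ℕ, (1 - q ^ (n + 1))
  have hL0 : L ≠ 0 := tprod_one_sub_pow_ne_zero hq
  have hlim : Tendsto (eulerProd q) atTop (nhds L) := tendsto_eulerProd hq
  obtain ⟨B, hB⟩ := (Metric.isBounded_range_of_tendsto _ hlim).exists_norm_le
  obtain ⟨C, hC⟩ := (Metric.isBounded_range_of_tendsto _ (hlim.inv₀ hL0)).exists_norm_le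
  replace hB (n : ℕ) : ‖eulerProd q n‖ ≤ B := hB _ ⟨n, rfl⟩
  replace hC (n : ℕ) : ‖(eulerProd q n)⁻¹‖ ≤ C := hC _ ⟨n, rfl⟩
  have hB0 : 0 ≤ B := (norm_nonneg _).trans (hB 0)
  have hC0 : 0 ≤ C := (norm_nonneg _).trans (hC 0)
  set t : ℕ → ℂ := fun j ↦ (-1) ^ j * (2 * j + 1) * q ^ (j + 1).choose 2
  let f : ℕ → ℕ → ℂ := fun N j ↦ if j ≤ N then
    t j * (eulerProd q (2 * N + 1) / (eulerProd q (N + 1 + j) * eulerProd q (N - j))) else 0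
  have hf (N : ℕ) : ∑' j, f N j = eulerProd q N ^ 2 := by
    rw [← sum_gaussBinom_eq_eulerProd_sq hq0 (eulerProd_ne_zero hq),
      tsum_eq_sum (s := Finset.range (N + 1))]
    · refine Finset.sum_congr rfl fun j hj ↦ if_pos ?_
      have := Finset.mem_range.1 hj
      omega
    · intro j hj
      refine if_neg ?_
      simpa using hj
  have key : Tendsto (fun N ↦ ∑' j, f N j) atTop (nhds (∑' j, t j * (L / (L * L)))) := by
    refine tendsto_tsum_of_dominated_convergence
      ((summable_norm_mul_pow_choose hq).mul_right (B * (C * C))) (fun j ↦ ?_)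
      (.of_forall fun N j ↦ ?_)
    · have h1 : Tendsto (fun N ↦ t j * (eulerProd q (2 * N + 1) /
          (eulerProd q (N + 1 + j) * eulerProd q (N - j)))) atTop (nhds (t j * (L / (L * L)))) := by
        refine Tendsto.const_mul _ (Tendsto.div ?_ (Tendsto.mul ?_ ?_) (mul_ne_zero hL0 hL0))
        · exact hlim.comp (tendsto_atTop_mono (fun n ↦ show n ≤ 2 * n + 1 by omega) tendsto_id)
        · exact hlim.comp (tendsto_atTop_mono (fun n ↦ show n ≤ n + 1 + j by omega) tendsto_id)
        · exact hlim.comp (tendsto_sub_atTop_nat j)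
      refine h1.congr' ?_
      filter_upwards [eventually_ge_atTop j] with N hN
      simp [f, hN]
    · by_cases h : j ≤ N
      · simp only [f, h, if_true]
        rw [norm_mul (t j), div_eq_mul_inv, mul_inv, norm_mul (eulerProd q (2 * N + 1)),
          norm_mul (eulerProd q (N + 1 + j))⁻¹]
        gcongr
        exacts [hB _, hC _, hC _]
      · simp only [f, h, if_false, norm_zero]
        positivity
  simp_rw [hf] at key
  have h := tendsto_nhds_unique key (hlim.pow 2)
  rw [tsum_mul_right] at h
  field_simp at h
  rw [h]

lemma summable_exp_quadratic (u : ℂ) {τ : ℂ} (hτ : 0 < τ.im) :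
    Summable fun n : ℤ ↦ cexp (2 * π * I * (n : ℂ) ^ 2 * τ + 2 * π * I * (n : ℂ) * u) := by
  refine ((summable_jacobiTheta₂_term_iff u (2 * τ)).2 (by simpa using hτ)).congr fun n ↦ ?_
  rw [jacobiTheta₂_term]
  congr 1
  ring

lemma summable_mul_exp_quadratic (u : ℂ) {τ : ℂ} (hτ : 0 < τ.im) :
    Summable fun n : ℤ ↦
      (n : ℂ) * cexp (2 * π * I * (n : ℂ) ^ 2 * τ + 2 * π * I * (n : ℂ) * u) := by
  refine (((summable_jacobiTheta₂'_term_iff u (2 * τ)).2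
    (by simpa using hτ)).mul_left (2 * π * I)⁻¹).congr fun n ↦ ?_
  rw [jacobiTheta₂'_term, jacobiTheta₂_term, mul_assoc (2 * π * I),
    inv_mul_cancel_left₀ two_pi_I_ne_zero]
  congr 2
  ring

lemma exp_quadratic_add_half (u τ : ℂ) (n : ℤ) :
    cexp (2 * π * I * ((n : ℂ) + 1 / 2) ^ 2 * τ + 2 * π * I * ((n : ℂ) + 1 / 2) * u) =
      cexp (π * I * (τ / 2 + u)) *
        cexp (2 * π * I * (n : ℂ) ^ 2 * τ + 2 * π * I * (n : ℂ) * (u + τ)) := by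
  rw [← Complex.exp_add]
  congr 1
  ring

lemma summable_exp_quadratic_add_half (u : ℂ) {τ : ℂ} (hτ : 0 < τ.im) :
    Summable fun n : ℤ ↦
      cexp (2 * π * I * ((n : ℂ) + 1 / 2) ^ 2 * τ + 2 * π * I * ((n : ℂ) + 1 / 2) * u) := by
  simp_rw [exp_quadratic_add_half]
  exact (summable_exp_quadratic _ hτ).mul_left _

lemma summable_mul_exp_quadratic_add_half (u : ℂ) {τ : ℂ} (hτ : 0 < τ.im) :
    Summable fun n : ℤ ↦ ((n : ℂ) + 1 / 2) *
      cexp (2 * π * I * ((n : ℂ) + 1 / 2) ^ 2 * τ + 2 * π * I * ((n : ℂ) + 1 / 2) * u) := by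
  simp_rw [exp_quadratic_add_half]
  refine (((summable_mul_exp_quadratic (u + τ) hτ).mul_left (cexp (π * I * (τ / 2 + u)))).add
    ((summable_exp_quadratic (u + τ) hτ).mul_left
      (1 / 2 * cexp (π * I * (τ / 2 + u))))).congr fun n ↦ ?_
  ring

/-- The sum of `μ e^{πiμ²τ}` over the `μ` in `2ℤ - k - 1/2`. -/
def oddThetaSum (τ : ℂ) (k : ℤ) : ℂ :=
  ∑' m : ℤ, (2 * (m : ℂ) - k - 1 / 2) * cexp (π * I * (2 * (m : ℂ) - k - 1 / 2) ^ 2 * τ)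

lemma oddThetaSum_add_one (τ : ℂ) (k : ℤ) : oddThetaSum τ (k + 1) = -oddThetaSum τ k := by
  rw [oddThetaSum, oddThetaSum, ← tsum_neg, ← (Equiv.subLeft (k + 1)).tsum_eq]
  refine tsum_congr fun m ↦ ?_
  simp only [Equiv.subLeft_apply]
  push_cast
  rw [show (2 * ((k : ℂ) + 1 - m) - (k + 1) - 1 / 2) = -(2 * (m : ℂ) - k - 1 / 2) by ring, neg_sq]
  ring

lemma oddThetaSum_eq_neg_one_zpow_mul (τ : ℂ) (k : ℤ) :
    oddThetaSum τ k = (-1) ^ k * oddThetaSum τ 0 := by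
  induction k using Int.induction_on with
  | zero => simp
  | succ k ih => rw [oddThetaSum_add_one, ih, zpow_add_one₀ (by simp)]; ring
  | pred k ih =>
    have h := oddThetaSum_add_one τ (-k - 1)
    rw [sub_add_cancel, ih] at h
    rw [← neg_eq_iff_eq_neg.2 h, zpow_sub_one₀ (by simp)]
    norm_num

lemma dedekindEta_cube_eq_tsum {τ : ℂ} (hτ : 0 < τ.im) :
    dedekindEta τ ^ 3 = ∑' j : ℕ, cexp (π * I * τ / 4) *
      ((-1) ^ j * (2 * j + 1) * cexp (2 * π * I * τ) ^ (j + 1).choose 2) := by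
  have hq : ‖cexp (2 * π * I * τ)‖ < 1 := UpperHalfPlane.norm_exp_two_pi_I_lt_one ⟨τ, hτ⟩
  rw [tsum_mul_left, ← tprod_one_sub_pow_cube (exp_ne_zero _) hq, dedekindEta, mul_pow,
    ← Complex.exp_nat_mul, show ((3 : ℕ) : ℂ) * (π * I * τ / 12) = π * I * τ / 4 by
      push_cast
      ring]
  congr 2
  · refine tprod_congr fun n ↦ ?_
    rw [← Complex.exp_nat_mul]
    congr 2
    push_cast
    ring

lemma oddThetaSum_zero {τ : ℂ} (hτ : 0 < τ.im) :
    oddThetaSum τ 0 = -(1 / 2) * dedekindEta τ ^ 3 := by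
  have hq : ‖cexp (2 * π * I * τ)‖ < 1 := UpperHalfPlane.norm_exp_two_pi_I_lt_one ⟨τ, hτ⟩
  rw [dedekindEta_cube_eq_tsum hτ, ← tsum_mul_left, oddThetaSum, ← (Equiv.neg ℤ).tsum_eq]
  set t : ℕ → ℂ := fun j ↦ -(1 / 2) * (cexp (π * I * τ / 4) *
      ((-1) ^ j * (2 * j + 1) * cexp (2 * π * I * τ) ^ (j + 1).choose 2))
  have hs : Summable t := ((summable_norm_mul_pow_choose hq).of_norm.mul_left _).mul_left _
  have hexp (j : ℕ) : cexp (π * I * τ / 4) * cexp (2 * π * I * τ) ^ (j + 1).choose 2 =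
      cexp (π * I * ((j : ℂ) + 1 / 2) ^ 2 * τ) := by
    rw [← Complex.exp_nat_mul, ← Complex.exp_add]
    congr 1
    rw [Nat.cast_choose_two]
    push_cast
    ring
  have htj (j : ℕ) : t j = -((-1) ^ j * (j + 1 / 2) * cexp (π * I * ((j : ℂ) + 1 / 2) ^ 2 * τ)) := by
    rw [← hexp]
    ring
  have h0 : Summable fun k ↦ t (2 * k) :=
    hs.comp_injective (mul_right_injective₀ two_ne_zero)
  have h1 : Summable fun k ↦ t (2 * k + 1) :=
    hs.comp_injective ((add_left_injective 1).comp (mul_right_injective₀ two_ne_zero))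
  rw [← tsum_even_add_odd h0 h1]
  have k0 : HasSum (fun k ↦ t (2 * k)) _ := h0.hasSum
  have k1 : HasSum (fun k ↦ t (2 * k + 1)) _ := h1.hasSum
  refine (HasSum.of_nat_of_neg_add_one ?_ ?_).tsum_eq
  · convert k0 using 2 with n
    rw [htj, pow_mul]
    simp only [Equiv.neg_apply]
    push_cast
    rw [show 2 * -(n : ℂ) - 0 - 1 / 2 = -(2 * n + 1 / 2) by ring, neg_sq]
    ring
  · convert k1 using 2 with n
    rw [htj, pow_succ (-1 : ℂ), pow_mul]
    simp only [Equiv.neg_apply]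
    push_cast
    rw [show 2 * -(-((n : ℂ) + 1)) - 0 - 1 / 2 = 2 * n + 1 + 1 / 2 by ring]
    ring

/-- The determinant identity a₀ϑ₁ - a₁ϑ₀ = (i/2) η³ ϑ. -/
theorem det_identity (τ : ℂ) (hτ : 0 < τ.im) (α β : ℝ) :
    aCoef0 α β τ * jTheta1 ((α : ℂ) * τ + β) (2 * τ)
      - aCoef1 α β τ * jTheta0 ((α : ℂ) * τ + β) (2 * τ)
    = (I / 2) * dedekindEta τ ^ 3 * jTheta ((α : ℂ) * τ + β) τ := by
  set u : ℂ := (α : ℂ) * τ + β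
  set e : ℤ → ℂ := fun n ↦ cexp (2 * π * I * (n : ℂ) ^ 2 * τ + 2 * π * I * (n : ℂ) * u) with he
  set f : ℤ → ℂ := fun n ↦
    cexp (2 * π * I * ((n : ℂ) + 1 / 2) ^ 2 * τ + 2 * π * I * ((n : ℂ) + 1 / 2) * u) with hf
  have se : Summable e := summable_exp_quadratic u hτ
  have sf : Summable f := summable_exp_quadratic_add_half u hτ
  have sme : Summable fun n : ℤ ↦ (n : ℂ) * e n := summable_mul_exp_quadratic u hτ
  have smf : Summable fun n : ℤ ↦ ((n : ℂ) + 1 / 2) * f n :=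
    summable_mul_exp_quadratic_add_half u hτ
  have h0 : jTheta0 u (2 * τ) = ∑' n, e n := by
    refine tsum_congr fun n ↦ ?_
    simp only [he]
    congr 1
    ring
  have h1 : jTheta1 u (2 * τ) = ∑' n, f n := by
    refine tsum_congr fun n ↦ ?_
    simp only [hf]
    congr 1
    ring
  have ha0 : aCoef0 α β τ = ∑' n : ℤ, (n : ℂ) * e n + α / 2 * ∑' n, e n := by
    rw [← tsum_mul_left, ← sme.tsum_add (se.mul_left _)]
    exact tsum_congr fun n ↦ add_mul _ _ _
  have ha1 : aCoef1 α β τ = ∑' n : ℤ, ((n : ℂ) + 1 / 2) * f n + α / 2 * ∑' n, f n := by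
    rw [← tsum_mul_left, ← smf.tsum_add (sf.mul_left _)]
    exact tsum_congr fun n ↦ add_mul _ _ _
  have s1 := summable_mul_of_summable_norm sme.norm sf.norm
  have s2 := summable_mul_of_summable_norm se.norm smf.norm
  let σ : ℤ × ℤ ≃ ℤ × ℤ :=
    { toFun := fun p ↦ (p.2, p.1 - p.2)
      invFun := fun p ↦ (p.1 + p.2, p.1)
      left_inv := fun p ↦ by simp
      right_inv := fun p ↦ by simp }
  have s3 := σ.summable_iff.2 (s1.sub s2)
  rw [Function.comp_def] at s3
  rw [h0, h1, ha0, ha1]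
  trans (∑' n : ℤ, (n : ℂ) * e n) * (∑' n, f n) -
    (∑' n, e n) * (∑' n : ℤ, ((n : ℂ) + 1 / 2) * f n)
  · ring
  rw [tsum_mul_tsum_of_summable_norm sme.norm sf.norm,
    tsum_mul_tsum_of_summable_norm se.norm smf.norm, ← s1.tsum_sub s2, ← σ.tsum_eq,
    s3.tsum_prod, jTheta, ← tsum_mul_left]
  refine tsum_congr fun k ↦ ?_
  trans cexp (π * I * ((k : ℂ) + 1 / 2) ^ 2 * τ + 2 * π * I * ((k : ℂ) + 1 / 2) * u) *
    oddThetaSum τ k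
  · rw [oddThetaSum, ← tsum_mul_left]
    refine tsum_congr fun m ↦ ?_
    have hef : e m * f (k - m) =
        cexp (π * I * ((k : ℂ) + 1 / 2) ^ 2 * τ + 2 * π * I * ((k : ℂ) + 1 / 2) * u) *
          cexp (π * I * (2 * (m : ℂ) - k - 1 / 2) ^ 2 * τ) := by
      simp only [he, hf]
      rw [← Complex.exp_add, ← Complex.exp_add]
      congr 1
      push_cast
      ring
    trans (2 * (m : ℂ) - k - 1 / 2) * (e m * f (k - m))
    · simp only [σ, Equiv.coe_fn_mk]
      push_cast
      ring
    · rw [hef]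
      ring
  · have hI : cexp (2 * π * I * ((k : ℂ) + 1 / 2) * (1 / 2)) = (-1) ^ k * I := by
      rw [show 2 * π * I * ((k : ℂ) + 1 / 2) * (1 / 2) = k * (π * I) + π / 2 * I by ring,
        Complex.exp_add, Complex.exp_int_mul, exp_pi_mul_I, exp_pi_div_two_mul_I]
    rw [oddThetaSum_eq_neg_one_zpow_mul, oddThetaSum_zero hτ,
      mul_add (2 * π * I * ((k : ℂ) + 1 / 2)) u, ← add_assoc,
      Complex.exp_add _ (2 * π * I * ((k : ℂ) + 1 / 2) * (1 / 2)), hI]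
    linear_combination (-(1 / 2) * (-1) ^ k * dedekindEta τ ^ 3 *
      cexp (π * I * ((k : ℂ) + 1 / 2) ^ 2 * τ + 2 * π * I * ((k : ℂ) + 1 / 2) * u)) * I_sq

end
end
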